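/- arXiv:2003.10980 — 2 statements merged into one kernel-verified Lean document; each statement's English description precedes it below -/
import Mathlib

section
/- Fix s ∈ (0,1/2) and let u(x,y) = Im((x+iy)^s) on the open upper half-plane. Then: (a) for every (x,y) with y > 0, the total derivative of u satisfies ‖Du(x,y)‖ = s·|x+iy|^{s−1}; (b) for every p ∈ [1,∞), the integral ∫_{B_1 ∩ {y>0}} ‖Du(x,y)‖^p dx dy is finite if and only if p < 2/(1−s). Moreover 2/(1−s) < 4, and 2/(1−s) → 2 as s → 0+. -/
open Set Filter Complex MeasureTheory Topology

/-- `u z = Im (z^s)` with the principal branch of the complex power. -/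
noncomputable def powIm' (s : ℝ) (z : ℂ) : ℝ := (z ^ (s : ℂ)).im


lemma powIm_aux_norm (s : ℝ) (hs : 0 < s) (z : ℂ) (hz : 0 < z.im) :
    ‖fderiv ℝ (powIm' s) z‖ = s * ‖z‖ ^ (s - 1) := by
  have hz0 : z ≠ 0 := by
    rintro rfl
    simp at hz
  have hsl : z ∈ slitPlane := Or.inr hz.ne'
  set c : ℂ := (s : ℂ) * z ^ ((s : ℂ) - 1) with hc
  have h1 : HasDerivAt (fun w : ℂ => w ^ (s : ℂ)) c z := by
    simpa using (hasDerivAt_id z).cpow_const (c := (s : ℂ)) hsl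
  have h2 := h1.hasFDerivAt.restrictScalars ℝ
  have h3 : HasFDerivAt (powIm' s) (imCLM.comp
      ((ContinuousLinearMap.toSpanSingleton ℂ c).restrictScalars ℝ)) z :=
    imCLM.hasFDerivAt.comp z h2
  have hcn : ‖c‖ = s * ‖z‖ ^ (s - 1) := by
    rw [hc, norm_mul, Complex.norm_real, Real.norm_of_nonneg hs.le]
    congr 1
    rw [← Complex.norm_cpow_real]
    push_cast
    rfl
  have hzpos : 0 < ‖z‖ := norm_pos_iff.mpr hz0
  have hcpos : 0 < ‖c‖ := by
    rw [hcn]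
    positivity
  rw [h3.fderiv, ← hcn]
  clear_value c
  apply le_antisymm
  · refine ContinuousLinearMap.opNorm_le_bound _ (norm_nonneg _) fun w => ?_
    have : ‖(w * c).im‖ ≤ ‖w * c‖ := Complex.abs_im_le_norm _
    rw [norm_mul, mul_comm ‖w‖] at this
    exact this
  · have h := (imCLM.comp
      ((ContinuousLinearMap.toSpanSingleton ℂ c).restrictScalars ℝ)).le_opNorm (I * (starRingEnd ℂ) c)
    have e : (imCLM.comp ((ContinuousLinearMap.toSpanSingleton ℂ c).restrictScalars ℝ))
        (I * (starRingEnd ℂ) c) = ‖c‖ ^ 2 := by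
      have : I * (starRingEnd ℂ) c * c = I * ((‖c‖ ^ 2 : ℝ) : ℂ) := by
        rw [mul_assoc, mul_comm _ c, Complex.mul_conj, Complex.normSq_eq_norm_sq]
      change (I * (starRingEnd ℂ) c * c).im = _
      rw [this, Complex.I_mul_im, Complex.ofReal_re]
    rw [e, norm_mul, Complex.norm_I, one_mul, RCLike.norm_conj,
      Real.norm_of_nonneg (by positivity), sq] at h
    exact le_of_mul_le_mul_right h hcpos

lemma powIm_aux_half (f : ℝ → ℝ) :
    IntegrableOn (fun z : ℂ => f ‖z‖) {z : ℂ | ‖z‖ < 1 ∧ 0 < z.im} volume ↔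
      IntegrableOn (fun z : ℂ => f ‖z‖) (Metric.ball (0 : ℂ) 1) volume := by
  constructor
  · intro h
    have h' : IntegrableOn (fun z : ℂ => f ‖z‖) {z : ℂ | ‖z‖ < 1 ∧ z.im < 0} volume := by
      have := ((Measure.measurePreserving_neg (volume : Measure ℂ)).integrableOn_comp_preimage
        (MeasurableEquiv.neg ℂ).measurableEmbedding (f := fun z : ℂ => f ‖z‖)
        (s := {z : ℂ | ‖z‖ < 1 ∧ 0 < z.im})).2 h
      simpa [Function.comp_def, Set.preimage] using this
    have h0 : volume {z : ℂ | z.im = 0} = 0 := by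
      have := Measure.addHaar_submodule (volume : Measure ℂ) (LinearMap.ker imLm) (by
        intro ht
        have : (I : ℂ) ∈ LinearMap.ker imLm := by rw [ht]; trivial
        simp at this)
      convert this using 2
      ext z
      simp
    have h00 : IntegrableOn (fun z : ℂ => f ‖z‖) {z : ℂ | z.im = 0} volume :=
      IntegrableOn.of_measure_zero h0
    refine ((h.union h').union h00).mono_set fun z hz => ?_
    have hz1 : ‖z‖ < 1 := by simpa using hz
    rcases lt_trichotomy z.im 0 with h | h | h
    · exact Or.inl (Or.inr ⟨hz1, h⟩)
    · exact Or.inr h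
    · exact Or.inl (Or.inl ⟨hz1, h⟩)
  · intro h
    exact h.mono_set fun z hz => by simpa using hz.1

/-- For `s ∈ (0,1/2)` and `u = Im z^s`: the (Euclidean) norm of `Du` equals
`s·|z|^{s−1}` on the upper half-plane, `|Du|^p` is integrable on the upper
half-disk iff `p < 2/(1−s)`, and moreover `2/(1−s) < 4` while
`2/(1−s) → 2` as `s → 0+`. -/
theorem powIm_gradient_Lp (s : ℝ) (hs : s ∈ Set.Ioo (0 : ℝ) (1 / 2)) :
    (∀ z : ℂ, 0 < z.im →
      ‖fderiv ℝ (powIm' s) z‖ = s * ‖z‖ ^ (s - 1)) ∧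
    (∀ p : ℝ, 1 ≤ p →
      (IntegrableOn (fun z : ℂ => ‖fderiv ℝ (powIm' s) z‖ ^ p)
          {z : ℂ | ‖z‖ < 1 ∧ 0 < z.im} volume ↔ p < 2 / (1 - s))) ∧
    (2 / (1 - s) < 4) ∧
    (Tendsto (fun t : ℝ => 2 / (1 - t)) (nhdsWithin 0 (Set.Ioi 0)) (nhds 2)) := by
  obtain ⟨hs0, hs1⟩ := hs
  have h1s : 0 < 1 - s := by linarith
  refine ⟨powIm_aux_norm s hs0, ?_, ?_, ?_⟩
  · intro p hp
    have hmeas : MeasurableSet {z : ℂ | ‖z‖ < 1 ∧ 0 < z.im} :=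
      ((isOpen_lt continuous_norm continuous_const).inter
        (isOpen_lt continuous_const Complex.continuous_im)).measurableSet
    have e1 : IntegrableOn (fun z : ℂ => ‖fderiv ℝ (powIm' s) z‖ ^ p)
          {z : ℂ | ‖z‖ < 1 ∧ 0 < z.im} volume ↔
        IntegrableOn (fun z : ℂ => (fun r : ℝ => (s * r ^ (s - 1)) ^ p) ‖z‖)
          {z : ℂ | ‖z‖ < 1 ∧ 0 < z.im} volume := by
      apply integrableOn_congr_fun _ hmeas
      intro z hz
      simp only [powIm_aux_norm s hs0 z hz.2]
    have e2 : IntegrableOn (fun y : ℝ => y ^ (Module.finrank ℝ ℂ - 1) •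
        (fun r : ℝ => (s * r ^ (s - 1)) ^ p) y) (Ioo 0 1) ↔
        IntegrableOn (fun y : ℝ => s ^ p * y ^ ((s - 1) * p + 1)) (Ioo 0 1) := by
      apply integrableOn_congr_fun _ measurableSet_Ioo
      intro y hy
      have hy0 : 0 < y := hy.1
      simp only [Complex.finrank_real_complex, smul_eq_mul]
      rw [Real.mul_rpow hs0.le (by positivity), ← Real.rpow_mul hy0.le, Real.rpow_add hy0,
        Real.rpow_one]
      norm_num
      ring
    rw [e1, powIm_aux_half (fun r : ℝ => (s * r ^ (s - 1)) ^ p),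
      integrableOn_fun_norm_addHaar volume (f := fun r : ℝ => (s * r ^ (s - 1)) ^ p), e2, IntegrableOn,
      integrable_const_mul_iff (Real.rpow_pos_of_pos hs0 p).ne'.isUnit, ← IntegrableOn,
      intervalIntegral.integrableOn_Ioo_rpow_iff one_pos, lt_div_iff₀ h1s]
    constructor <;> intro h <;> nlinarith
  · rw [div_lt_iff₀ h1s]
    linarith
  · have : ContinuousAt (fun t : ℝ => 2 / (1 - t)) 0 := by
      apply ContinuousAt.div <;> first | fun_prop | norm_num
    have h := this.tendsto
    norm_num at h
    exact h.mono_left nhdsWithin_le_nhds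
end

section
/- Let γ ∈ [0,1/48] and let Ω ⊆ ℝ^d satisfy the γ-Reifenberg-flatness assumption with parameter R1. Let D ⊆ ∂Ω, x0 ∈ cl(Ω), R ∈ (0,R1/4], and suppose D ∩ B_R(x0) ≠ ∅ and that there exist z0 ∈ D ∩ B_R(x0) and α ∈ (0,1) such that B_{αR}(z0) ⊆ B_R(x0) and ∂Ω ∩ B_{αR}(z0) ⊆ D ∩ B_R(x0). Then there is a constant C = C(d,α) such that for every smooth compactly supported function u : ℝ^d → ℝ with support(u) ∩ D = ∅ one has ‖u‖_{L²(Ω∩B_R(x0))} ≤ C·R·‖∇u‖_{L²(Ω∩B_{2R}(x0))}. -/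
open Set Filter MeasureTheory Metric Topology

noncomputable section

/-- `ℝ^d` with the Euclidean norm. -/
abbrev Euc (d : ℕ) := EuclideanSpace ℝ (Fin d)

/-- A smooth compactly supported test function. -/
def IsTest {d : ℕ} (ζ : Euc d → ℝ) : Prop := ContDiff ℝ (⊤ : ℕ∞) ζ ∧ HasCompactSupport ζ

/-- The gradient vector of a differentiable function, as an element of `ℝ^d`. -/
def gradVec {d : ℕ} (ζ : Euc d → ℝ) (x : Euc d) : Euc d :=
  WithLp.toLp 2 (fun i => fderiv ℝ ζ x (EuclideanSpace.single i 1) : Fin d → ℝ)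

/-- The `i`-th partial derivative. -/
def pder {d : ℕ} (i : Fin d) (ζ : Euc d → ℝ) (x : Euc d) : ℝ :=
  fderiv ℝ ζ x (EuclideanSpace.single i 1)

/-- `g` is the weak gradient of `u` on the open set `V`. -/
def HasWeakGradOn {d : ℕ} (u : Euc d → ℝ) (g : Euc d → Euc d) (V : Set (Euc d)) : Prop :=
  ∀ i : Fin d, ∀ ζ : Euc d → ℝ, IsTest ζ → tsupport ζ ⊆ V →
    ∫ x in V, u x * pder i ζ x = - ∫ x in V, g x i * ζ x

/-- `u` (with weak gradient `g`) is approximable in `W^{1,p}(V)` by smooth compactly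
supported functions whose support avoids `D`; this encodes membership in `W^{1,p}_D`. -/
def ApproxWD {d : ℕ} (u : Euc d → ℝ) (g : Euc d → Euc d) (D V : Set (Euc d)) (p : ℝ) : Prop :=
  ∃ un : ℕ → Euc d → ℝ,
    (∀ n, IsTest (un n) ∧ Function.support (un n) ∩ D = ∅) ∧
    Tendsto (fun n => ∫ x in V, |un n x - u x| ^ p) atTop (nhds 0) ∧
    Tendsto (fun n => ∫ x in V, ‖gradVec (un n) x - g x‖ ^ p) atTop (nhds 0)

/-- Membership in `W^{1,p}_D(V)` : `u, g ∈ L^p`, `g` is the weak gradient of `u` on `V`,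
and `u` is approximable by smooth functions vanishing near no point of `D`. -/
def MemW1pD {d : ℕ} (u : Euc d → ℝ) (g : Euc d → Euc d) (D V : Set (Euc d)) (p : ℝ) : Prop :=
  MemLp u (ENNReal.ofReal p) (volume.restrict V) ∧
  MemLp g (ENNReal.ofReal p) (volume.restrict V) ∧
  HasWeakGradOn u g V ∧ ApproxWD u g D V p

/-- The `γ`-Reifenberg flatness assumption with parameter `R1`. -/
def ReifenbergFlat {d : ℕ} (Ω : Set (Euc d)) (γ R1 : ℝ) : Prop :=
  ∀ x0 ∈ frontier Ω, ∀ R ∈ Set.Ioc (0 : ℝ) R1, ∃ ν : Euc d, ‖ν‖ = 1 ∧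
    ({x ∈ ball x0 R | γ * R < inner ℝ (x - x0) ν} ⊆ Ω) ∧
    (Ω ∩ ball x0 R ⊆ {x | -(γ * R) < (inner ℝ (x - x0) ν : ℝ)})

/-- `M`-Lipschitz functions `ℝ^m → ℝ`. -/
def LipConst {m : ℕ} (M : ℝ) (φ : Euc m → ℝ) : Prop :=
  ∀ a b : Euc m, |φ a - φ b| ≤ M * ‖a - b‖

/-- The boundary of `Ω` is decomposed into disjoint nonempty pieces `N` (conormal part)
and `D` (Dirichlet part). -/
def BoundarySplit {d : ℕ} (Ω N D : Set (Euc d)) : Prop :=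
  frontier Ω = N ∪ D ∧ N ∩ D = ∅ ∧ N.Nonempty ∧ D.Nonempty

/-- The interface `Γ = cl N ∩ cl D` is a `(γ,m)`-flat separation with parameter `R1`:
at every point of `Γ` and scale `R ≤ R1` there are orthonormal vectors
`ν 0, …, ν (m+1)`, with `ν 0` a Reifenberg flatness direction for `Ω`, and an
`M`-Lipschitz function `φ : ℝ^m → ℝ` such that, in the corresponding coordinates,
the parts of `∂Ω ∩ B_R(x0)` lying above/below the graph of `φ` at height `±γR`
belong to `D` resp. `N`. -/
def FlatSeparation {d : ℕ} (Ω N D : Set (Euc d)) (m : ℕ) (M γ R1 : ℝ) : Prop :=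
  ∀ x0 ∈ closure N ∩ closure D, ∀ R ∈ Set.Ioc (0 : ℝ) R1,
    ∃ ν : Fin (m + 2) → Euc d, Orthonormal ℝ ν ∧
      ({x ∈ ball x0 R | γ * R < inner ℝ (x - x0) (ν 0)} ⊆ Ω) ∧
      (Ω ∩ ball x0 R ⊆ {x | -(γ * R) < (inner ℝ (x - x0) (ν 0) : ℝ)}) ∧
      ∃ φ : Euc m → ℝ, LipConst M φ ∧
        (frontier Ω ∩ ball x0 R ∩
            {x | φ (WithLp.toLp 2 ((fun i : Fin m => (inner ℝ (x - x0) (ν ⟨i.1 + 2, by omega⟩) : ℝ)) :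
                Fin m → ℝ)) + γ * R < (inner ℝ (x - x0) (ν 1) : ℝ)} ⊆ D) ∧
        (frontier Ω ∩ ball x0 R ∩
            {x | (inner ℝ (x - x0) (ν 1) : ℝ) < φ (WithLp.toLp 2 ((fun i : Fin m =>
                (inner ℝ (x - x0) (ν ⟨i.1 + 2, by omega⟩) : ℝ)) : Fin m → ℝ)) - γ * R} ⊆ N)

/-- Average of `h` over `E`. -/
def avg {d : ℕ} (E : Set (Euc d)) (h : Euc d → ℝ) : ℝ :=
  (volume E).toReal⁻¹ * ∫ x in E, h x

/-- Symmetric, measurable, uniformly `Λ`-elliptic coefficients. -/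
def EllipticSym {d : ℕ} (a : Fin d → Fin d → Euc d → ℝ) (Λ : ℝ) : Prop :=
  (∀ i j, Measurable (a i j)) ∧ (∀ i j x, a i j x = a j i x) ∧
  (∀ x : Euc d, ∀ ξ : Fin d → ℝ,
    Λ * (∑ i, ξ i ^ 2) ≤ ∑ i, ∑ j, a i j x * ξ j * ξ i ∧
      ∑ i, ∑ j, a i j x * ξ j * ξ i ≤ Λ⁻¹ * (∑ i, ξ i ^ 2))

/-- The `(θ, R1)`-small BMO condition on `Ω`. -/
def SmallBMO {d : ℕ} (a : Fin d → Fin d → Euc d → ℝ) (Ω : Set (Euc d)) (θ R1 : ℝ) : Prop :=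
  ∀ i j, ∀ x ∈ closure Ω, ∀ r ∈ Set.Ioc (0 : ℝ) R1,
    avg (Ω ∩ ball x r) (fun y => |a i j y - avg (Ω ∩ ball x r) (a i j)|) < θ

/-- `u ∈ W^{1,2}_D(Ω)` with weak gradient `g` is a weak solution of
`D_i(a_{ij} D_j u) − λ u = f + D_i f_i` in `Ω` with conormal condition
`a_{ij} D_j u n_i = f_i n_i` on `N` and `u = 0` on `D`. -/
def WeakSolMixed {d : ℕ} (a : Fin d → Fin d → Euc d → ℝ) (lam : ℝ)
    (u : Euc d → ℝ) (g : Euc d → Euc d) (f : Euc d → ℝ) (fv : Fin d → Euc d → ℝ)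
    (Ω D : Set (Euc d)) : Prop :=
  ∀ ζ : Euc d → ℝ, IsTest ζ → tsupport ζ ∩ closure D = ∅ →
    ∫ x in Ω, (-(∑ i, ∑ j, a i j x * g x j * pder i ζ x) - lam * u x * ζ x)
      = (∫ x in Ω, f x * ζ x) - ∫ x in Ω, ∑ i, fv i x * pder i ζ x

end

open Set Filter MeasureTheory Metric Topology

open scoped ENNReal

lemma pm_sq_lintegral_le {X : Type*} [MeasurableSpace X] (μ : Measure X) [IsProbabilityMeasure μ]
    {F : X → ℝ≥0∞} (hF : AEMeasurable F μ) :
    (∫⁻ x, F x ∂μ) ^ 2 ≤ ∫⁻ x, F x ^ 2 ∂μ := by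
  have h := ENNReal.lintegral_mul_le_Lp_mul_Lq μ Real.HolderConjugate.two_two hF
    (aemeasurable_const (b := (1 : ℝ≥0∞)))
  simp only [Pi.mul_apply, mul_one, ENNReal.one_rpow, lintegral_one, measure_univ] at h
  calc (∫⁻ x, F x ∂μ) ^ 2 ≤ ((∫⁻ x, F x ^ (2:ℝ) ∂μ) ^ (1 / (2:ℝ))) ^ 2 := by gcongr
    _ = ∫⁻ x, F x ^ 2 ∂μ := by
      rw [← ENNReal.rpow_natCast, ← ENNReal.rpow_mul]
      norm_num

lemma pm_fderiv_le {d : ℕ} (u : Euc d → ℝ) (x v : Euc d) :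
    ‖fderiv ℝ u x v‖ₑ ≤ ‖gradVec u x‖ₑ * ‖v‖ₑ := by
  have h1 : fderiv ℝ u x v = inner ℝ (gradVec u x) v := by
    have hv : v = ∑ i, v i • EuclideanSpace.single i (1:ℝ) := by
      ext j
      simp [Finset.sum_apply, Pi.single_apply]
    conv_lhs => rw [hv]
    rw [map_sum, PiLp.inner_apply]
    refine Finset.sum_congr rfl fun i _ => ?_
    simp [gradVec]
  rw [h1]
  have := norm_inner_le_norm (𝕜 := ℝ) (gradVec u x) v
  rw [← ofReal_norm, ← ofReal_norm, ← ofReal_norm, ← ENNReal.ofReal_mul (norm_nonneg _)]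
  exact ENNReal.ofReal_le_ofReal this

lemma pm_grad_cont {d : ℕ} (u : Euc d → ℝ) (hu : ContDiff ℝ 1 u) : Continuous (gradVec u) := by
  unfold gradVec
  have h := hu.continuous_fderiv (by norm_num)
  fun_prop

/-- squared gradient, cut off to `U` -/
noncomputable def pmH {d : ℕ} (u : Euc d → ℝ) (U : Set (Euc d)) : Euc d → ℝ≥0∞ :=
  U.indicator (fun x => ‖gradVec u x‖ₑ ^ 2)

lemma pmH_meas {d : ℕ} (u : Euc d → ℝ) (hu : ContDiff ℝ 1 u) (U : Set (Euc d)) (hU : IsOpen U) :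
    Measurable (pmH u U) := by
  refine Measurable.indicator ?_ hU.measurableSet
  have := (pm_grad_cont u hu).measurable
  fun_prop

lemma pm_line {d : ℕ} (u : Euc d → ℝ) (hu : ContDiff ℝ 1 u) (U : Set (Euc d)) (hU : IsOpen U)
    (p v : Euc d) (T : ℝ) (hT : T ∈ Icc (0:ℝ) 1) (h : ∀ t ∈ Ico (0:ℝ) T, p + t • v ∈ U) :
    ‖u (p + T • v) - u p‖ₑ ^ 2 ≤ ‖v‖ₑ ^ 2 * ∫⁻ t in Icc (0:ℝ) 1, pmH u U (p + t • v) := by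
  have hc := hu.continuous_fderiv (by norm_num)
  have hd : ∀ t : ℝ, HasDerivAt (fun t : ℝ => u (p + t • v)) (fderiv ℝ u (p + t • v) v) t := by
    intro t
    have h1 : HasDerivAt (fun t : ℝ => p + t • v) v t := by
      simpa using ((hasDerivAt_id t).smul_const v).const_add p
    exact ((hu.differentiable (by norm_num)) (p + t • v)).hasFDerivAt.comp_hasDerivAt t h1
  have hcont : Continuous fun t : ℝ => fderiv ℝ u (p + t • v) v := by fun_prop
  have h2 := intervalIntegral.integral_eq_sub_of_hasDerivAt (a := 0) (b := T)
    (fun t _ => hd t) (hcont.intervalIntegrable _ _)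
  simp only [zero_smul, add_zero] at h2
  rw [← h2, intervalIntegral.integral_of_le hT.1, ← integral_Ico_eq_integral_Ioc]
  set G : ℝ → ℝ≥0∞ := fun t => U.indicator (fun x => ‖gradVec u x‖ₑ) (p + t • v) * ‖v‖ₑ with hG
  have hGm : Measurable G := by
    have h3 : Measurable (U.indicator (fun x => ‖gradVec u x‖ₑ)) :=
      ((pm_grad_cont u hu).measurable.enorm).indicator hU.measurableSet
    have h4 : Measurable fun t : ℝ => p + t • v := by fun_prop
    exact (h3.comp h4).mul_const _
  have : IsProbabilityMeasure (volume.restrict (Icc (0:ℝ) 1)) := ⟨by simp⟩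
  have h5 : ‖∫ t in Ico 0 T, fderiv ℝ u (p + t • v) v‖ₑ ≤ ∫⁻ t in Icc (0:ℝ) 1, G t := by
    calc _ ≤ ∫⁻ t in Ico 0 T, ‖fderiv ℝ u (p + t • v) v‖ₑ := enorm_integral_le_lintegral_enorm _
      _ ≤ ∫⁻ t in Ico 0 T, G t := by
        refine setLIntegral_mono hGm fun t ht => ?_
        simp only [hG, indicator_of_mem (h t ht)]
        exact pm_fderiv_le _ _ _
      _ ≤ _ := lintegral_mono_set (show Ico (0:ℝ) T ⊆ Icc (0:ℝ) 1 from
        fun t ht => ⟨ht.1, ht.2.le.trans hT.2⟩)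
  calc _ ≤ (∫⁻ t in Icc (0:ℝ) 1, G t) ^ 2 := by gcongr
    _ ≤ ∫⁻ t in Icc (0:ℝ) 1, G t ^ 2 := pm_sq_lintegral_le _ hGm.aemeasurable
    _ = ∫⁻ t in Icc (0:ℝ) 1, ‖v‖ₑ ^ 2 * pmH u U (p + t • v) := by
      congr 1; ext t
      simp only [hG, pmH, indicator]
      split_ifs
      · ring
      · simp
    _ = _ := by
      rw [lintegral_const_mul' _ _ (by simp)]

/-- normalized volume on the unit ball -/
noncomputable def pmMu (d : ℕ) : Measure (Euc d) :=
  (volume (ball (0 : Euc d) 1))⁻¹ • volume.restrict (ball (0 : Euc d) 1)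

lemma pmK_pos (d : ℕ) : volume (ball (0 : Euc d) 1) ≠ 0 := (measure_ball_pos _ _ one_pos).ne'
lemma pmK_top (d : ℕ) : volume (ball (0 : Euc d) 1) ≠ ∞ := measure_ball_lt_top.ne

instance pmMu_prob (d : ℕ) : IsProbabilityMeasure (pmMu d) :=
  ⟨by simp [pmMu, ENNReal.inv_mul_cancel (pmK_pos d) (pmK_top d)]⟩

lemma pmMu_ae (d : ℕ) : ∀ᵐ z ∂(pmMu d), z ∈ ball (0 : Euc d) 1 := by
  unfold pmMu
  exact Measure.ae_smul_measure (ae_restrict_mem measurableSet_ball) _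

lemma pm_subst {d : ℕ} (f : Euc d → ℝ≥0∞) (hf : Measurable f) (c : Euc d) (ρ : ℝ) (hρ : 0 < ρ) :
    ∫⁻ z, f (c + ρ • z) = (ENNReal.ofReal (ρ ^ d))⁻¹ * ∫⁻ z, f z := by
  have h1 := lintegral_map (μ := volume) (f := fun y => f (c + y)) (g := fun z : Euc d => ρ • z)
    (by fun_prop) (by fun_prop)
  rw [← h1, Measure.map_addHaar_smul _ hρ.ne', lintegral_smul_measure,
    lintegral_add_left_eq_self]
  simp only [finrank_euclideanSpace, Fintype.card_fin, smul_eq_mul]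
  rw [abs_of_pos (by positivity), ENNReal.ofReal_inv_of_pos (by positivity)]

/-- the bounding functional -/
noncomputable def pmPhi {d : ℕ} (h : Euc d → ℝ≥0∞) (x : Euc d) (r : ℝ) : ℝ≥0∞ :=
  ENNReal.ofReal ((2 * r) ^ 2) * ((volume (ball (0 : Euc d) 1))⁻¹ *
    ((ENNReal.ofReal ((r / 64) ^ d))⁻¹ * ∫⁻ y in ball x r, h y))

lemma pm_core {d : ℕ} (h : Euc d → ℝ≥0∞) (hm : Measurable h) (F : Euc d → ℝ) (hF : Measurable F)
    (c c' : Euc d) (ρ ρ' : ℝ) (x : Euc d) (r : ℝ) (hr : 0 < r) (hρ : r / 64 ≤ ρ) (hρ' : r / 64 ≤ ρ')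
    (hsub : ball c ρ ⊆ ball x r) (hsub' : ball c' ρ' ⊆ ball x r)
    (hb : ∀ z ∈ ball (0 : Euc d) 1, ‖F z‖ₑ ^ 2 ≤ ‖(c' + ρ' • z) - (c + ρ • z)‖ₑ ^ 2 *
      ∫⁻ t in Icc (0:ℝ) 1, h ((c + ρ • z) + t • ((c' + ρ' • z) - (c + ρ • z)))) :
    ‖∫ z, F z ∂(pmMu d)‖ₑ ^ 2 ≤ pmPhi h x r := by
  have hr64 : 0 < r / 64 := by positivity
  have hρ0 : 0 < ρ := hr64.trans_le hρ
  have hρ0' : 0 < ρ' := hr64.trans_le hρ'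
  have key : ∀ (c : Euc d) (ρ : ℝ), 0 < ρ → ball c ρ ⊆ ball x r → ∀ z ∈ ball (0 : Euc d) 1,
      c + ρ • z ∈ ball x r := by
    intro c ρ h0 hs z hz
    apply hs
    rw [mem_ball_zero_iff] at hz
    rw [mem_ball, dist_eq_norm, add_sub_cancel_left, norm_smul, Real.norm_of_nonneg h0.le]
    nlinarith
  set P : Euc d → ℝ → Euc d := fun z t => (c + ρ • z) + t • ((c' + ρ' • z) - (c + ρ • z)) with hP
  set g : Euc d → ℝ≥0∞ := (ball x r).indicator h with hg
  have hgm : Measurable g := hm.indicator measurableSet_ball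
  have hgP : Measurable (Function.uncurry fun z t => g (P z t)) := by
    apply hgm.comp
    simp only [hP]
    fun_prop
  have hPm : ∀ z, Measurable (P z) := by
    intro z; simp only [hP]; fun_prop
  have hL : ∀ z ∈ ball (0 : Euc d) 1, ‖F z‖ₑ ^ 2 ≤ ENNReal.ofReal ((2 * r) ^ 2) *
      ∫⁻ t in Icc (0:ℝ) 1, g (P z t) := by
    intro z hz
    have h1 := key c ρ hρ0 hsub z hz
    have h2 := key c' ρ' hρ0' hsub' z hz
    refine (hb z hz).trans ?_
    gcongr ?_ * ?_
    · rw [← ofReal_norm, ← ENNReal.ofReal_pow (norm_nonneg _)]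
      apply ENNReal.ofReal_le_ofReal
      gcongr
      rw [← dist_eq_norm]
      rw [mem_ball] at h1 h2
      linarith [dist_triangle_right (c' + ρ' • z) (c + ρ • z) x]
    · refine setLIntegral_mono (hgm.comp (hPm z)) fun t ht => ?_
      have h3 : P z t ∈ ball x r := by
        have := (convex_ball x r).add_smul_sub_mem h1 h2 ht
        exact this
      change h (P z t) ≤ (ball x r).indicator h (P z t)
      rw [indicator_of_mem h3]
  calc ‖∫ z, F z ∂(pmMu d)‖ₑ ^ 2 ≤ (∫⁻ z, ‖F z‖ₑ ∂(pmMu d)) ^ 2 := by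
        gcongr; exact enorm_integral_le_lintegral_enorm _
    _ ≤ ∫⁻ z, ‖F z‖ₑ ^ 2 ∂(pmMu d) := pm_sq_lintegral_le _ hF.enorm.aemeasurable
    _ ≤ ∫⁻ z, ENNReal.ofReal ((2 * r) ^ 2) * (∫⁻ t in Icc (0:ℝ) 1, g (P z t)) ∂(pmMu d) := by
        refine lintegral_mono_ae ?_
        filter_upwards [pmMu_ae d] with z hz using hL z hz
    _ = ENNReal.ofReal ((2 * r) ^ 2) * ∫⁻ t in Icc (0:ℝ) 1, ∫⁻ z, g (P z t) ∂(pmMu d) := by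
        rw [lintegral_const_mul' _ _ (by simp), lintegral_lintegral_swap hgP.aemeasurable]
    _ ≤ ENNReal.ofReal ((2 * r) ^ 2) * ∫⁻ t in Icc (0:ℝ) 1, ((volume (ball (0 : Euc d) 1))⁻¹ *
          ((ENNReal.ofReal ((r / 64) ^ d))⁻¹ * ∫⁻ y in ball x r, h y)) := by
        refine mul_le_mul_right ?_ _
        refine setLIntegral_mono measurable_const fun t ht => ?_
        rw [pmMu, lintegral_smul_measure, smul_eq_mul]
        refine mul_le_mul_right ?_ _
        have hρt : r / 64 ≤ (1 - t) * ρ + t * ρ' := by nlinarith [ht.1, ht.2]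
        have hPt : ∀ z, P z t = ((1 - t) • c + t • c') + ((1 - t) * ρ + t * ρ') • z := by
          intro z; simp only [hP]; module
        calc _ ≤ ∫⁻ z, g (P z t) := setLIntegral_le_lintegral _ _
          _ = (ENNReal.ofReal (((1 - t) * ρ + t * ρ') ^ d))⁻¹ * ∫⁻ z, g z := by
            simp only [hPt]
            exact pm_subst g hgm _ _ (hr64.trans_le hρt)
          _ ≤ _ := by
            rw [hg, lintegral_indicator measurableSet_ball]
            gcongr
    _ = pmPhi h x r := by
        simp [pmPhi]

/-- ball averages -/
noncomputable def pmA {d : ℕ} (u : Euc d → ℝ) (c : Euc d) (ρ : ℝ) : ℝ :=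
  ∫ z, u (c + ρ • z) ∂(pmMu d)

lemma pm_int {d : ℕ} (u : Euc d → ℝ) (hu : Continuous u) (c : Euc d) (ρ : ℝ) :
    Integrable (fun z => u (c + ρ • z)) (pmMu d) := by
  unfold pmMu
  refine Integrable.smul_measure ?_ (ENNReal.inv_ne_top.2 (pmK_pos d))
  have h : Continuous fun z : Euc d => u (c + ρ • z) := by fun_prop
  exact (h.continuousOn.integrableOn_compact (isCompact_closedBall (0 : Euc d) 1)).mono_set
    ball_subset_closedBall

lemma pm_step {d : ℕ} (u : Euc d → ℝ) (hu : ContDiff ℝ 1 u) (U : Set (Euc d)) (hU : IsOpen U)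
    (c c' : Euc d) (ρ ρ' : ℝ) (x : Euc d) (r : ℝ) (hr : 0 < r) (hρ : r / 64 ≤ ρ) (hρ' : r / 64 ≤ ρ')
    (hsub : ball c ρ ⊆ ball x r) (hsub' : ball c' ρ' ⊆ ball x r)
    (K : Set (Euc d)) (hK : Convex ℝ K) (hKU : K ⊆ U) (h1 : ball c ρ ⊆ K) (h2 : ball c' ρ' ⊆ K) :
    ‖pmA u c' ρ' - pmA u c ρ‖ₑ ^ 2 ≤ pmPhi (pmH u U) x r := by
  have hc := hu.continuous
  rw [pmA, pmA, ← integral_sub (pm_int u hc _ _) (pm_int u hc _ _)]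
  have hr64 : 0 < r / 64 := by positivity
  have key : ∀ (c : Euc d) (ρ : ℝ), 0 < ρ → ball c ρ ⊆ K → ∀ z ∈ ball (0 : Euc d) 1,
      c + ρ • z ∈ K := by
    intro c ρ h0 hs z hz
    apply hs
    rw [mem_ball_zero_iff] at hz
    rw [mem_ball, dist_eq_norm, add_sub_cancel_left, norm_smul, Real.norm_of_nonneg h0.le]
    nlinarith
  refine pm_core _ (pmH_meas u hu U hU) _ (by fun_prop) c c' ρ ρ' x r hr hρ hρ' hsub hsub' ?_
  intro z hz
  have := pm_line u hu U hU (c + ρ • z) ((c' + ρ' • z) - (c + ρ • z)) 1 (by simp) ?_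
  · simpa using this
  · intro t ht
    exact hKU (hK.add_smul_sub_mem (key c ρ (hr64.trans_le hρ) h1 z hz)
      (key c' ρ' (hr64.trans_le hρ') h2 z hz) ⟨ht.1, ht.2.le⟩)

lemma pm_conn {d : ℕ} (Ω s : Set (Euc d)) (hs : IsPreconnected s) (hne : (s ∩ interior Ω).Nonempty)
    (hf : ∀ x ∈ s, x ∉ frontier Ω) : s ⊆ interior Ω := by
  refine hs.subset_of_closure_inter_subset isOpen_interior hne ?_
  rintro x ⟨hx, hxs⟩
  by_contra hn
  exact hf x hxs ⟨closure_mono interior_subset hx, hn⟩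

lemma pm_dir {d : ℕ} (u : Euc d → ℝ) (hu : ContDiff ℝ 1 u) (Ω : Set (Euc d))
    (c c' : Euc d) (ρ ρ' : ℝ) (x : Euc d) (r : ℝ) (hr : 0 < r) (hρ : r / 64 ≤ ρ) (hρ' : r / 64 ≤ ρ')
    (hsub : ball c ρ ⊆ ball x r) (hsub' : ball c' ρ' ⊆ ball x r)
    (h1 : ball c ρ ⊆ interior Ω) (h2 : ball c' ρ' ∩ Ω = ∅)
    (hD : ∀ y ∈ frontier Ω ∩ ball x r, u y = 0) :
    ‖pmA u c ρ‖ₑ ^ 2 ≤ pmPhi (pmH u (interior Ω)) x r := by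
  have hc := hu.continuous
  have hr64 : 0 < r / 64 := by positivity
  have key : ∀ (c : Euc d) (ρ : ℝ), 0 < ρ → ∀ z ∈ ball (0 : Euc d) 1,
      c + ρ • z ∈ ball c ρ := by
    intro c ρ h0 z hz
    rw [mem_ball_zero_iff] at hz
    rw [mem_ball, dist_eq_norm, add_sub_cancel_left, norm_smul, Real.norm_of_nonneg h0.le]
    nlinarith
  refine pm_core _ (pmH_meas u hu _ isOpen_interior) _ (by fun_prop) c c' ρ ρ' x r hr hρ hρ'
    hsub hsub' ?_
  intro z hz
  have k1 := key c ρ (hr64.trans_le hρ) z hz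
  have k2 := key c' ρ' (hr64.trans_le hρ') z hz
  set p := c + ρ • z with hp
  set v := c' + ρ' • z - p with hv
  have hpv : p + (1:ℝ) • v = c' + ρ' • z := by rw [hv]; module
  have hpath : Continuous fun t : ℝ => p + t • v := by fun_prop
  set S : Set ℝ := Icc (0:ℝ) 1 ∩ (fun t : ℝ => p + t • v) ⁻¹' (frontier Ω) with hS
  have hSc : IsCompact S :=
    isCompact_Icc.inter_right (isClosed_frontier.preimage hpath)
  have hSne : S.Nonempty := by
    by_contra hne
    rw [not_nonempty_iff_eq_empty] at hne
    have := pm_conn Ω ((fun t : ℝ => p + t • v) '' Icc (0:ℝ) 1)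
      (isPreconnected_Icc.image _ hpath.continuousOn)
      ⟨p, ⟨0, by simp, by simp⟩, h1 k1⟩ (by
        rintro _ ⟨t, ht, rfl⟩ hf
        have : t ∈ S := ⟨ht, hf⟩
        simp [hne] at this)
    have h3 : c' + ρ' • z ∈ interior Ω := this ⟨1, by simp, hpv⟩
    have h4 : c' + ρ' • z ∈ ball c' ρ' ∩ Ω := ⟨k2, interior_subset h3⟩
    simp [h2] at h4
  obtain ⟨T, hTS, hTmin⟩ := hSc.exists_isLeast hSne
  have hpin : ∀ t ∈ Icc (0:ℝ) 1, p + t • v ∈ ball x r := fun t ht =>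
    (convex_ball x r).add_smul_sub_mem (hsub k1) (hsub' k2) ht
  have hu0 : u (p + T • v) = 0 := hD _ ⟨hTS.2, hpin T hTS.1⟩
  have := pm_line u hu (interior Ω) isOpen_interior p v T hTS.1 ?_
  · simpa [hu0] using this
  · intro t ht
    have hh := pm_conn Ω ((fun t : ℝ => p + t • v) '' Ico (0:ℝ) T)
      (isPreconnected_Ico.image _ hpath.continuousOn)
      ⟨p, ⟨0, ⟨le_rfl, ht.1.trans_lt ht.2⟩, by simp⟩, h1 k1⟩ (by
        rintro _ ⟨s, hs, rfl⟩ hf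
        have : s ∈ S := ⟨⟨hs.1, hs.2.le.trans hTS.1.2⟩, hf⟩
        exact absurd (hTmin this) (not_le.2 hs.2))
    exact hh ⟨t, ht, rfl⟩

/-- the upper part of a ball -/
def pmHalf {d : ℕ} (y : Euc d) (S γ : ℝ) (ν : Euc d) : Set (Euc d) :=
  {x ∈ ball y S | γ * S < inner ℝ (x - y) ν}

lemma pmHalf_eq {d : ℕ} (y : Euc d) (S γ : ℝ) (ν : Euc d) :
    pmHalf y S γ ν = ball y S ∩ {x | γ * S + inner ℝ ν y < innerSL ℝ ν x} := by
  ext x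
  simp only [pmHalf, mem_ofPred_eq, mem_inter_iff, innerSL_apply_apply, inner_sub_right,
    real_inner_comm ν, and_congr_right_iff]
  intro _
  constructor <;> intro h <;> linarith

lemma pmHalf_convex {d : ℕ} (y : Euc d) (S γ : ℝ) (ν : Euc d) : Convex ℝ (pmHalf y S γ ν) := by
  rw [pmHalf_eq]
  exact (convex_ball _ _).inter (convex_halfSpace_gt (innerSL ℝ ν).isLinear _)

lemma pmHalf_open {d : ℕ} (y : Euc d) (S γ : ℝ) (ν : Euc d) : IsOpen (pmHalf y S γ ν) := by
  rw [pmHalf_eq]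
  exact isOpen_ball.inter (isOpen_lt continuous_const (innerSL ℝ ν).continuous)

lemma pm_inner_le {d : ℕ} (a ν : Euc d) (hν : ‖ν‖ = 1) : |inner ℝ a ν| ≤ ‖a‖ := by
  have := abs_real_inner_le_norm a ν
  rwa [hν, mul_one] at this

lemma pm_ball_half {d : ℕ} (y : Euc d) (S γ : ℝ) (ν : Euc d) (hν : ‖ν‖ = 1) (c : Euc d) (ρ : ℝ)
    (h1 : dist c y + ρ ≤ S) (h2 : γ * S + ρ ≤ inner ℝ (c - y) ν) : ball c ρ ⊆ pmHalf y S γ ν := by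
  intro p hp
  rw [mem_ball] at hp
  refine ⟨?_, ?_⟩
  · rw [mem_ball]
    linarith [dist_triangle p c y]
  · have h3 := pm_inner_le (p - c) ν hν
    rw [← dist_eq_norm] at h3
    have h4 : inner ℝ (p - y) ν = inner ℝ (p - c) ν + inner ℝ (c - y) ν := by
      rw [← inner_add_left]; congr 1; abel
    rw [h4]
    linarith [(abs_le.1 h3).1]

lemma pm_above {d : ℕ} (Ω : Set (Euc d)) (y : Euc d) (S γ : ℝ) (ν : Euc d) (hν : ‖ν‖ = 1)
    (hB : Ω ∩ ball y S ⊆ {x | -(γ * S) < (inner ℝ (x - y) ν : ℝ)})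
    (c : Euc d) (ρ : ℝ) (h1 : ball c ρ ⊆ Ω) (h2 : ball c ρ ⊆ ball y S) (hρ : 0 < ρ) :
    ρ - γ * S ≤ inner ℝ (c - y) ν := by
  have : ∀ t ∈ Ioo 0 ρ, t ≤ inner ℝ (c - y) ν + γ * S := by
    intro t ht
    have hm : c - t • ν ∈ ball c ρ := by
      rw [mem_ball, dist_eq_norm, sub_sub_cancel_left, norm_neg, norm_smul, hν, mul_one,
        Real.norm_of_nonneg ht.1.le]
      exact ht.2
    have h3 : -(γ * S) < inner ℝ (c - t • ν - y) ν := hB ⟨h1 hm, h2 hm⟩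
    have h4 : inner ℝ (c - t • ν - y) ν = inner ℝ (c - y) ν - t := by
      rw [show c - t • ν - y = (c - y) - t • ν by abel, inner_sub_left, inner_smul_left,
        real_inner_self_eq_norm_sq, hν]
      simp
    linarith
  have h5 : ρ ≤ inner ℝ (c - y) ν + γ * S := by
    refine le_of_forall_lt_imp_le_of_dense fun t ht => ?_
    by_cases h0 : 0 < t
    · exact this t ⟨h0, ht⟩
    · exact (not_lt.1 h0).trans (le_trans (by positivity) (this (ρ / 2) ⟨by positivity, by linarith⟩))
  linarith

lemma pm_angle {d : ℕ} (ν ν' : Euc d) (hν : ‖ν‖ = 1) (hν' : ‖ν'‖ = 1)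
    (h : ∀ q : Euc d, ‖q‖ < 1 → 1 / 48 < inner ℝ q ν → -(1 / 3 : ℝ) < inner ℝ q ν') :
    (3 / 4 : ℝ) ≤ inner ℝ ν ν' := by
  by_contra hcon
  push Not at hcon
  set a : ℝ := inner ℝ ν ν' with ha
  have hb : 0 < 1 - a := by linarith
  set s : ℝ := 0.35 / (1 - a) with hs
  have hsb : s * (1 - a) = 0.35 := by rw [hs]; field_simp
  have e1 : inner ℝ ν ν = (1:ℝ) := by rw [real_inner_self_eq_norm_sq, hν]; norm_num
  have e2 : inner ℝ ν' ν' = (1:ℝ) := by rw [real_inner_self_eq_norm_sq, hν']; norm_num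
  have e3 : inner ℝ ν' ν = a := by rw [real_inner_comm]
  have i1 : inner ℝ (s • (ν - ν')) ν = s * (1 - a) := by
    rw [real_inner_smul_left, inner_sub_left, e1, e3]
  have i2 : inner ℝ (s • (ν - ν')) ν' = - (s * (1 - a)) := by
    rw [real_inner_smul_left, inner_sub_left, e2, ← ha]; ring
  have hn : ‖s • (ν - ν')‖ < 1 := by
    have : ‖s • (ν - ν')‖ ^ 2 = 2 * s * (s * (1 - a)) := by
      rw [← real_inner_self_eq_norm_sq, real_inner_smul_right, inner_sub_right, i1, i2]; ring
    have hs1 : s < 1.4 := by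
      rw [hs, div_lt_iff₀ hb]; linarith
    rw [hsb] at this
    have : ‖s • (ν - ν')‖ ^ 2 < 1 ^ 2 := by rw [this]; linarith
    exact lt_of_pow_lt_pow_left₀ 2 (by norm_num) this
  have := h _ hn (by rw [i1, hsb]; norm_num)
  rw [i2, hsb] at this
  norm_num at this

lemma pm_angle2 {d : ℕ} (Ω : Set (Euc d)) (γ : ℝ) (hγ : γ ∈ Set.Icc (0 : ℝ) (1 / 48))
    (y y' ν ν' : Euc d) (S S' : ℝ) (hS : 0 < S) (hν : ‖ν‖ = 1) (hν' : ‖ν'‖ = 1)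
    (hA : pmHalf y S γ ν ⊆ Ω)
    (hB : Ω ∩ ball y' S' ⊆ {x | -(γ * S') < (inner ℝ (x - y') ν' : ℝ)})
    (hd : dist y y' + S ≤ S') (hβ : inner ℝ (y - y') ν' + γ * S' ≤ S / 3) :
    (3 / 4 : ℝ) ≤ inner ℝ ν ν' := by
  refine pm_angle ν ν' hν hν' fun q hq hqν => ?_
  have hn : ‖S • q‖ < S := by
    rw [norm_smul, Real.norm_of_nonneg hS.le]; nlinarith
  have h1 : y + S • q ∈ ball y S := by
    rwa [mem_ball, dist_eq_norm, add_sub_cancel_left]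
  have h2 : y + S • q ∈ Ω := by
    refine hA ⟨h1, ?_⟩
    rw [add_sub_cancel_left, real_inner_smul_left]
    nlinarith [hγ.2]
  have h3 : y + S • q ∈ ball y' S' := by
    rw [mem_ball] at h1 ⊢
    linarith [dist_triangle (y + S • q) y y']
  have h4 : -(γ * S') < inner ℝ (y + S • q - y') ν' := hB ⟨h2, h3⟩
  rw [show y + S • q - y' = (y - y') + S • q by abel, inner_add_left, real_inner_smul_left] at h4
  have h5 : S * (-(1 / 3)) < S * inner ℝ q ν' := by linarith
  exact lt_of_mul_lt_mul_left h5 hS.le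

lemma pm_chain {d : ℕ} (Ω : Set (Euc d)) (γ R1 : ℝ) (hγ : γ ∈ Set.Icc (0 : ℝ) (1 / 48))
    (hflat : ReifenbergFlat Ω γ R1) (z0 : Euc d) (hz0 : z0 ∈ frontier Ω) (R : ℝ) (hR : 0 < R)
    (hR1 : 4 * R ≤ R1) (ν0 : Euc d) (hν0 : ‖ν0‖ = 1)
    (hA0 : pmHalf z0 (4 * R) γ ν0 ⊆ Ω)
    (hB0 : Ω ∩ ball z0 (4 * R) ⊆ {x | -(γ * (4 * R)) < (inner ℝ (x - z0) ν0 : ℝ)})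
    (x : Euc d) (hx : x ∈ closure Ω) (hxz : dist x z0 < 2 * R) :
    ∃ c : ℝ → Euc d, (∀ S ∈ Ioc 0 R1, dist (c S) x ≤ 5 / 4 * S ∧
        ∃ K : Set (Euc d), Convex ℝ K ∧ K ⊆ interior Ω ∧ ball (c S) (S / 16) ⊆ K ∧
          ball (c (S / 2)) (S / 32) ⊆ K) ∧
      ball (c (R / 2)) (R / 32) ⊆ pmHalf z0 (4 * R) γ ν0 := by
  obtain ⟨hγ0, hγ1⟩ := hγ
  obtain ⟨y, hy, hδ⟩ := isClosed_frontier.exists_infDist_eq_dist ⟨z0, hz0⟩ x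
  set δ := dist x y with hδdef
  have hδ0 : 0 ≤ δ := dist_nonneg
  have hball : ∀ r, r ≤ δ → 0 < r → ball x r ⊆ interior Ω := by
    intro r hr hr0
    refine pm_conn Ω _ (convex_ball x r).isPreconnected ⟨x, mem_ball_self hr0, ?_⟩ ?_
    · by_contra hn
      have : infDist x (frontier Ω) = 0 := infDist_zero_of_mem ⟨hx, hn⟩
      linarith
    · intro p hp hpf
      have := infDist_le_dist_of_mem (x := x) hpf
      rw [mem_ball, dist_comm] at hp
      linarith
  have hex : ∀ S : ℝ, ∃ ν : Euc d, S ∈ Ioc 0 R1 → ‖ν‖ = 1 ∧ pmHalf y S γ ν ⊆ Ω ∧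
      (Ω ∩ ball y S ⊆ {x | -(γ * S) < (inner ℝ (x - y) ν : ℝ)}) := by
    intro S
    by_cases hS : S ∈ Ioc 0 R1
    · obtain ⟨ν, hν⟩ := hflat y hy S hS
      exact ⟨ν, fun _ => hν⟩
    · exact ⟨0, fun h => absurd h hS⟩
  choose ν hν using hex
  have hint : ∀ S ∈ Ioc 0 R1, pmHalf y S γ (ν S) ⊆ interior Ω := fun S hS =>
    interior_maximal (hν S hS).2.1 (pmHalf_open _ _ _ _)
  have einner : ∀ (t : ℝ) (w w' : Euc d), inner ℝ (y + t • w - y) w' = t * inner ℝ w w' := by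
    intro t w w'
    rw [add_sub_cancel_left, real_inner_smul_left]
  have edist : ∀ t : ℝ, 0 ≤ t → ∀ S ∈ Ioc 0 R1, dist (y + t • ν S) y = t := by
    intro t ht S hS
    rw [dist_eq_norm, add_sub_cancel_left, norm_smul, (hν S hS).1, mul_one, Real.norm_of_nonneg ht]
  have eself : ∀ S ∈ Ioc 0 R1, inner ℝ (ν S) (ν S) = (1:ℝ) := by
    intro S hS
    rw [real_inner_self_eq_norm_sq, (hν S hS).1]; norm_num
  refine ⟨fun S => if 2 * δ ≤ S then y + (3 / 4 * S) • ν S else x, fun S hS => ⟨?_, ?_⟩, ?_⟩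
  · -- distance
    dsimp only
    split_ifs with h
    · have := dist_triangle_right (y + (3 / 4 * S) • ν S) x y
      rw [edist _ (by linarith [hS.1]) S hS] at this
      linarith
    · rw [dist_self]; linarith [hS.1]
  · have hS0 := hS.1
    have hS2 : S / 2 ∈ Ioc 0 R1 := ⟨by linarith, by linarith [hS.2]⟩
    have hγS : γ * S ≤ S / 48 := by nlinarith
    dsimp only
    by_cases h1 : 2 * δ ≤ S
    · rw [if_pos h1]
      refine ⟨pmHalf y S γ (ν S), pmHalf_convex _ _ _ _, hint S hS, ?_, ?_⟩
      · apply pm_ball_half _ _ _ _ (hν S hS).1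
        · rw [edist _ (by linarith) S hS]; linarith
        · rw [einner, eself S hS]; linarith
      · by_cases h2 : 2 * δ ≤ S / 2
        · rw [if_pos h2]
          have ha := pm_angle2 Ω γ ⟨hγ0, hγ1⟩ y y (ν (S / 2)) (ν S) (S / 2) S hS2.1 (hν _ hS2).1
            (hν _ hS).1 (hν _ hS2).2.1 (hν _ hS).2.2 (by rw [dist_self]; linarith)
            (by rw [sub_self, inner_zero_left]; linarith)
          apply pm_ball_half _ _ _ _ (hν S hS).1
          · rw [edist _ (by linarith) _ hS2]; linarith
          · rw [einner]; nlinarith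
        · rw [if_neg h2]
          push Not at h2
          have hd0 : 0 < δ := by linarith
          have h3 := pm_above Ω y S γ (ν S) (hν S hS).1 (hν S hS).2.2 x δ
            ((hball δ le_rfl hd0).trans interior_subset) (by
              intro p hp
              rw [mem_ball] at hp ⊢
              linarith [dist_triangle p x y]) hd0
          apply pm_ball_half _ _ _ _ (hν S hS).1
          · linarith
          · linarith
    · have h2 : ¬ 2 * δ ≤ S / 2 := by linarith
      rw [if_neg h1, if_neg h2]
      refine ⟨ball x (S / 16), convex_ball _ _, hball _ (by linarith) (by linarith), subset_rfl,
        ball_subset_ball (by linarith)⟩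
  · have hγR : γ * (4 * R) ≤ R / 12 := by nlinarith
    have hSm : R / 2 ∈ Ioc 0 R1 := ⟨by linarith, by linarith⟩
    dsimp only
    split_ifs with h
    · have hyz : dist y z0 < 9 / 4 * R := by
        have := dist_triangle_left y z0 x
        linarith
      have hyb : y ∈ ball z0 (4 * R) := by rw [mem_ball]; linarith
      have hlow : -(γ * (4 * R)) ≤ inner ℝ (y - z0) ν0 := by
        have h1 : y ∈ closure (Ω ∩ ball z0 (4 * R)) := by
          rw [inter_comm]
          exact isOpen_ball.inter_closure ⟨hyb, hy.1⟩
        have hcl : IsClosed {p : Euc d | -(γ * (4 * R)) ≤ inner ℝ (p - z0) ν0} :=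
          isClosed_le continuous_const (by fun_prop)
        have hss : Ω ∩ ball z0 (4 * R) ⊆ {p : Euc d | -(γ * (4 * R)) ≤ inner ℝ (p - z0) ν0} := by
          intro p hp
          have h2 : -(γ * (4 * R)) < inner ℝ (p - z0) ν0 := hB0 hp
          exact h2.le
        exact closure_minimal hss hcl h1
      have hup : inner ℝ (y - z0) ν0 ≤ γ * (4 * R) := by
        by_contra hn
        push Not at hn
        exact hy.2 (interior_maximal hA0 (pmHalf_open _ _ _ _) ⟨hyb, hn⟩)
      have ha := pm_angle2 Ω γ ⟨hγ0, hγ1⟩ y z0 (ν (R / 2)) ν0 (R / 2) (4 * R) hSm.1 (hν _ hSm).1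
            hν0 (hν _ hSm).2.1 hB0 (by linarith) (by linarith)
      apply pm_ball_half _ _ _ _ hν0
      · have h1 := dist_triangle (y + (3 / 4 * (R / 2)) • ν (R / 2)) y z0
        rw [edist _ (by linarith) _ hSm] at h1
        linarith
      · rw [show y + (3 / 4 * (R / 2)) • ν (R / 2) - z0 =
          (y - z0) + (3 / 4 * (R / 2)) • ν (R / 2) by abel, inner_add_left, real_inner_smul_left]
        nlinarith
    · push Not at h
      have h3 := pm_above Ω z0 (4 * R) γ ν0 hν0 hB0 x (R / 4)
        ((hball (R / 4) (by linarith) (by linarith)).trans interior_subset) (by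
          intro p hp
          rw [mem_ball] at hp ⊢
          linarith [dist_triangle p x z0]) (by linarith)
      apply pm_ball_half _ _ _ _ hν0
      · linarith
      · linarith

lemma pm_enorm_sq (x : ℝ) : ‖x‖ₑ ^ 2 = ENNReal.ofReal (x ^ 2) := by
  rw [← ofReal_norm, ← ENNReal.ofReal_pow (norm_nonneg _), Real.norm_eq_abs, sq_abs]

lemma pm_add_sq (x y : ℝ) : ‖x + y‖ₑ ^ 2 ≤ 2 * ‖x‖ₑ ^ 2 + 2 * ‖y‖ₑ ^ 2 := by
  rw [pm_enorm_sq, pm_enorm_sq, pm_enorm_sq, ← mul_add,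
    ← ENNReal.ofReal_add (by positivity) (by positivity),
    show (2 : ℝ≥0∞) = ENNReal.ofReal 2 by simp, ← ENNReal.ofReal_mul (by norm_num)]
  apply ENNReal.ofReal_le_ofReal
  nlinarith [sq_nonneg (x - y)]

lemma pm_tel (n : ℕ) : ∀ (a : ℕ → ℝ) (M : ℕ → ℝ≥0∞),
    (∀ k, ‖a (k + 1) - a k‖ₑ ^ 2 ≤ M k) →
    ‖a n - a 0‖ₑ ^ 2 ≤ 2 * ∑ k ∈ Finset.range n, 2 ^ k * M k := by
  induction n with
  | zero => intro a M _; simp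
  | succ n ih =>
    intro a M h
    have h1 := ih (fun k => a (k + 1)) (fun k => M (k + 1)) (fun k => h (k + 1))
    have h2 := pm_add_sq (a 1 - a 0) (a (n + 1) - a 1)
    rw [show a 1 - a 0 + (a (n + 1) - a 1) = a (n + 1) - a 0 by ring] at h2
    refine h2.trans ?_
    rw [Finset.sum_range_succ', mul_add, add_comm]
    gcongr
    · refine h1.trans (le_of_eq ?_)
      rw [Finset.mul_sum]
      refine Finset.sum_congr rfl fun k _ => ?_
      ring
    · simpa using h 0

lemma pm_tel_lim (a : ℕ → ℝ) (M : ℕ → ℝ≥0∞) (l : ℝ) (hl : Tendsto a atTop (𝓝 l))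
    (h : ∀ k, ‖a (k + 1) - a k‖ₑ ^ 2 ≤ M k) :
    ‖l - a 0‖ₑ ^ 2 ≤ 2 * ∑' k, 2 ^ k * M k := by
  have h1 : Tendsto (fun n => ‖a n - a 0‖ₑ ^ 2) atTop (𝓝 (‖l - a 0‖ₑ ^ 2)) := by
    have hc : Continuous fun t : ℝ => ‖t - a 0‖ₑ ^ 2 := by
      simp only [pm_enorm_sq]
      exact ENNReal.continuous_ofReal.comp (by fun_prop)
    exact (hc.tendsto l).comp hl
  refine le_of_tendsto' h1 fun n => (pm_tel n a M h).trans ?_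
  gcongr
  exact ENNReal.sum_le_tsum _

lemma pm_A_tendsto {d : ℕ} (u : Euc d → ℝ) (hu : Continuous u) (hs : HasCompactSupport u)
    (x : Euc d) (c : ℕ → Euc d) (ρ : ℕ → ℝ) (hc : Tendsto c atTop (𝓝 x))
    (hρ : Tendsto ρ atTop (𝓝 0)) : Tendsto (fun k => pmA u (c k) (ρ k)) atTop (𝓝 (u x)) := by
  obtain ⟨C, hC⟩ := hs.exists_bound_of_continuous hu
  have h1 : u x = ∫ _z, u x ∂(pmMu d) := by simp
  rw [h1]
  refine tendsto_integral_of_dominated_convergence (fun _ => C) ?_ (integrable_const C) ?_ ?_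
  · intro n
    exact (pm_int u hu _ _).1
  · intro n
    exact Eventually.of_forall fun z => hC _
  · refine Eventually.of_forall fun z => ?_
    refine (hu.tendsto x).comp ?_
    simpa using hc.add (hρ.smul_const z)

lemma pm_alg (d : ℕ) (A B D : ℝ) (hA : 0 ≤ A) (hB : 0 < B) (J : ℝ≥0∞) :
    ENNReal.ofReal A * ((volume (ball (0 : Euc d) 1))⁻¹ * ((ENNReal.ofReal B)⁻¹ * J)) *
      (ENNReal.ofReal D * volume (ball (0 : Euc d) 1)) = ENNReal.ofReal (A * (D / B)) * J := by
  rw [ENNReal.ofReal_mul hA, ENNReal.ofReal_div_of_pos hB, div_eq_mul_inv]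
  calc _ = ((volume (ball (0 : Euc d) 1))⁻¹ * volume (ball (0 : Euc d) 1)) *
        (ENNReal.ofReal A * (ENNReal.ofReal D * (ENNReal.ofReal B)⁻¹) * J) := by ring
    _ = _ := by rw [ENNReal.inv_mul_cancel (pmK_pos d) (pmK_top d), one_mul]

lemma pm_vol {d : ℕ} (x : Euc d) (r : ℝ) (hr : 0 < r) :
    volume (ball x r) = ENNReal.ofReal (r ^ d) * volume (ball (0 : Euc d) 1) := by
  rw [Measure.addHaar_ball_of_pos _ _ hr]
  simp

lemma pm_const {d : ℕ} (h : Euc d → ℝ≥0∞) (z x0 : Euc d) (r R : ℝ) (hr : 0 < r) (hR : 0 < R)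
    (hs : ball z r ⊆ ball x0 (2 * R)) (hr2 : r ≤ 2 * R) (q : ℝ) (hq : (64 * R / r) ^ d ≤ q) :
    pmPhi h z r * volume (ball x0 R) ≤ 16 * (ENNReal.ofReal (R ^ 2 * q) *
      ∫⁻ y in ball x0 (2 * R), h y) := by
  rw [pm_vol x0 R hR, pmPhi, pm_alg d _ _ _ (by positivity) (by positivity), ← mul_assoc,
    show (16 : ℝ≥0∞) = ENNReal.ofReal 16 by simp, ← ENNReal.ofReal_mul (by norm_num)]
  refine mul_le_mul' (ENNReal.ofReal_le_ofReal ?_) (lintegral_mono_set hs)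
  have e : R ^ d / (r / 64) ^ d = (64 * R / r) ^ d := by
    rw [← div_pow]; congr 1; field_simp
  rw [e]
  have h1 : (2 * r) ^ 2 ≤ 16 * R ^ 2 := by nlinarith
  calc (2 * r) ^ 2 * (64 * R / r) ^ d ≤ (16 * R ^ 2) * q := by
        gcongr
    _ = _ := by ring

lemma pm_phi_meas {d : ℕ} (h : Euc d → ℝ≥0∞) (hm : Measurable h) (r : ℝ) :
    Measurable fun x => pmPhi h x r := by
  unfold pmPhi
  refine Measurable.const_mul (Measurable.const_mul (Measurable.const_mul ?_ _) _) _
  have h1 : ∀ x, ∫⁻ y in ball x r, h y =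
      ∫⁻ y, ({p : Euc d × Euc d | dist p.2 p.1 < r}.indicator (fun p => h p.2)) (x, y) := by
    intro x
    rw [← lintegral_indicator measurableSet_ball]
    rfl
  simp only [h1]
  refine Measurable.lintegral_prod_right' (f := ({p : Euc d × Euc d | dist p.2 p.1 < r}.indicator
    (fun p => h p.2))) ?_
  refine Measurable.indicator (by fun_prop) ?_
  exact (isOpen_lt (by fun_prop) (by fun_prop)).measurableSet

lemma pm_tonelli {d : ℕ} (h : Euc d → ℝ≥0∞) (hm : Measurable h) (x0 : Euc d) (r R : ℝ) (hr : 0 < r)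
    (hrR : r ≤ R) :
    ∫⁻ x in ball x0 R, pmPhi h x r ≤ ENNReal.ofReal ((2 * r) ^ 2 * 64 ^ d) *
      ∫⁻ y in ball x0 (2 * R), h y := by
  set g := (ball x0 (2 * R)).indicator h with hg
  have hgm : Measurable g := hm.indicator measurableSet_ball
  set F : Euc d → Euc d → ℝ≥0∞ := fun x y => (ball y r).indicator (fun _ => g y) x with hF
  have hFm : Measurable (Function.uncurry F) := by
    have : Function.uncurry F =
        {p : Euc d × Euc d | dist p.1 p.2 < r}.indicator (fun p => g p.2) := rfl
    rw [this]
    refine Measurable.indicator (by fun_prop) ?_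
    exact (isOpen_lt (by fun_prop) (by fun_prop)).measurableSet
  have hFx : ∀ x, Measurable (F x) := by
    intro x
    have : F x = {y : Euc d | dist x y < r}.indicator g := rfl
    rw [this]
    exact hgm.indicator (isOpen_lt (by fun_prop) (by fun_prop)).measurableSet
  have h1 : ∫⁻ x in ball x0 R, ∫⁻ y in ball x r, h y ≤
      (∫⁻ y in ball x0 (2 * R), h y) * volume (ball (0 : Euc d) r) := by
    calc ∫⁻ x in ball x0 R, ∫⁻ y in ball x r, h y ≤ ∫⁻ x in ball x0 R, ∫⁻ y, F x y := by
          refine setLIntegral_mono hFm.lintegral_prod_right fun x hx => ?_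
          refine (setLIntegral_mono (hFx x) fun y hy => ?_).trans (setLIntegral_le_lintegral _ _)
          have hxy : x ∈ ball y r := mem_ball_comm.1 hy
          have hy2 : y ∈ ball x0 (2 * R) := by
            rw [mem_ball] at hx hy ⊢
            linarith [dist_triangle y x x0]
          simp only [hF, indicator_of_mem hxy, hg, indicator_of_mem hy2, le_refl]
      _ ≤ ∫⁻ x, ∫⁻ y, F x y := setLIntegral_le_lintegral _ _
      _ = ∫⁻ y, ∫⁻ x, F x y := lintegral_lintegral_swap hFm.aemeasurable
      _ = ∫⁻ y, g y * volume (ball (0 : Euc d) r) := by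
          congr 1; ext y
          simp only [hF]
          rw [lintegral_indicator measurableSet_ball, setLIntegral_const,
            Measure.addHaar_ball_center]
      _ = _ := by
          rw [lintegral_mul_const _ hgm, hg, lintegral_indicator measurableSet_ball]
  have hB : (0:ℝ) < (r / 64) ^ d := by positivity
  have hBi : (ENNReal.ofReal ((r / 64) ^ d))⁻¹ ≠ ∞ := by
    rw [ENNReal.inv_ne_top]; simpa using hB
  unfold pmPhi
  rw [lintegral_const_mul' _ _ (by simp), lintegral_const_mul' _ _ (ENNReal.inv_ne_top.2 (pmK_pos d)),
    lintegral_const_mul' _ _ hBi]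
  rw [pm_vol _ _ hr] at h1
  calc _ ≤ ENNReal.ofReal ((2 * r) ^ 2) * ((volume (ball (0 : Euc d) 1))⁻¹ *
      ((ENNReal.ofReal ((r / 64) ^ d))⁻¹ * ((∫⁻ y in ball x0 (2 * R), h y) *
        (ENNReal.ofReal (r ^ d) * volume (ball (0 : Euc d) 1))))) := by gcongr
    _ = ENNReal.ofReal ((2 * r) ^ 2) * ((volume (ball (0 : Euc d) 1))⁻¹ *
      ((ENNReal.ofReal ((r / 64) ^ d))⁻¹ * (∫⁻ y in ball x0 (2 * R), h y))) *
        (ENNReal.ofReal (r ^ d) * volume (ball (0 : Euc d) 1)) := by ring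
    _ = _ := by
      rw [pm_alg d _ _ _ (by positivity) hB, ← div_pow]
      congr 4
      field_simp

lemma pm_chain_step {d : ℕ} (u : Euc d → ℝ) (hu : ContDiff ℝ 1 u) (Ω : Set (Euc d)) (R1 : ℝ)
    (x : Euc d) (c : ℝ → Euc d)
    (hc : ∀ S ∈ Ioc 0 R1, dist (c S) x ≤ 5 / 4 * S ∧
        ∃ K : Set (Euc d), Convex ℝ K ∧ K ⊆ interior Ω ∧ ball (c S) (S / 16) ⊆ K ∧
          ball (c (S / 2)) (S / 32) ⊆ K) (R : ℝ) (hR : 0 < R) (hR1 : R / 2 ≤ R1) (k : ℕ) :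
    ‖pmA u (c (R / 2 * (1 / 2) ^ (k + 1))) (R / 2 * (1 / 2) ^ (k + 1) / 16) -
      pmA u (c (R / 2 * (1 / 2) ^ k)) (R / 2 * (1 / 2) ^ k / 16)‖ₑ ^ 2 ≤
      pmPhi (pmH u (interior Ω)) x (R * (1 / 2) ^ k) := by
  set S := R / 2 * (1 / 2) ^ k with hS
  have e1 : R / 2 * (1 / 2) ^ (k + 1) = S / 2 := by rw [hS, pow_succ]; ring
  have e2 : R * (1 / 2) ^ k = 2 * S := by rw [hS]; ring
  have hS0 : 0 < S := by positivity
  have hS1 : S ≤ R1 := by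
    have : ((1:ℝ) / 2) ^ k ≤ 1 := pow_le_one₀ (by norm_num) (by norm_num)
    nlinarith
  obtain ⟨hd1, K, hK, hKU, k1, k2⟩ := hc S ⟨hS0, hS1⟩
  obtain ⟨hd2, -⟩ := hc (S / 2) ⟨by linarith, by linarith⟩
  rw [e1, e2, show S / 2 / 16 = S / 32 by ring]
  refine pm_step u hu (interior Ω) isOpen_interior _ _ _ _ x (2 * S) (by linarith) (by linarith)
    (by linarith) ?_ ?_ K hK hKU k1 k2
  · exact ball_subset_ball' (by linarith)
  · exact ball_subset_ball' (by linarith)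

lemma pm_seq (R : ℝ) : Tendsto (fun k : ℕ => R / 2 * (1 / 2 : ℝ) ^ k) atTop (𝓝 0) := by
  have := (tendsto_pow_atTop_nhds_zero_of_lt_one (r := (1/2 : ℝ)) (by norm_num) (by norm_num)).const_mul
    (R / 2)
  simpa using this

lemma pm_point {d : ℕ} (u : Euc d → ℝ) (hu : ContDiff ℝ 1 u) (hsupp : HasCompactSupport u)
    (Ω : Set (Euc d)) (γ R1 : ℝ) (hγ : γ ∈ Set.Icc (0 : ℝ) (1 / 48)) (hflat : ReifenbergFlat Ω γ R1)
    (x0 z0 : Euc d) (hz0 : z0 ∈ frontier Ω) (R : ℝ) (hR : 0 < R) (hR1 : 4 * R ≤ R1)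
    (hzx : dist z0 x0 < R) (N : ℕ)
    (hD : ∀ y ∈ frontier Ω ∩ ball z0 (R * (1 / 2) ^ N), u y = 0)
    (x : Euc d) (hx : x ∈ closure Ω) (hxx : dist x x0 < R) :
    ‖u x‖ₑ ^ 2 ≤ 4 * (∑' k : ℕ, 2 ^ k * pmPhi (pmH u (interior Ω)) x (R * (1 / 2) ^ k)) +
      (4 * pmPhi (pmH u (interior Ω)) x0 (2 * R) +
      (16 * (∑ k ∈ Finset.range N, 2 ^ k * pmPhi (pmH u (interior Ω)) z0 (R * (1 / 2) ^ k)) +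
        8 * pmPhi (pmH u (interior Ω)) z0 (R * (1 / 2) ^ N))) := by
  set H := pmH u (interior Ω) with hH
  obtain ⟨ν0, hν0, hA0, hB0⟩ := hflat z0 hz0 (4 * R) ⟨by linarith, hR1⟩
  obtain ⟨c, hc, hc0⟩ := pm_chain Ω γ R1 hγ hflat z0 hz0 R hR hR1 ν0 hν0 hA0 hB0 x hx
    (by linarith [dist_triangle_right x z0 x0])
  obtain ⟨b, hb, hb0⟩ := pm_chain Ω γ R1 hγ hflat z0 hz0 R hR hR1 ν0 hν0 hA0 hB0 z0 hz0.1
    (by rw [dist_self]; linarith)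
  have hR2 : R / 2 ∈ Ioc 0 R1 := ⟨by linarith, by linarith⟩
  set s : ℕ → ℝ := fun k => R / 2 * (1 / 2) ^ k with hs
  set A : ℕ → ℝ := fun k => pmA u (c (s k)) (s k / 16) with hA
  set B : ℕ → ℝ := fun k => pmA u (b (s k)) (s k / 16) with hB
  have hspos : ∀ k, 0 < s k := fun k => by simp only [hs]; positivity
  have hsle : ∀ k, s k ≤ R / 2 := fun k => by
    have : ((1:ℝ) / 2) ^ k ≤ 1 := pow_le_one₀ (by norm_num) (by norm_num)
    simp only [hs]; nlinarith
  have hlim : Tendsto A atTop (𝓝 (u x)) := by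
    refine pm_A_tendsto u hu.continuous hsupp x _ _ ?_ ?_
    · rw [tendsto_iff_dist_tendsto_zero]
      have h1 : Tendsto (fun k => 5 / 4 * s k) atTop (𝓝 0) := by
        simpa [hs] using (pm_seq R).const_mul (5 / 4)
      exact squeeze_zero (fun _ => dist_nonneg)
        (fun k => (hc (s k) ⟨hspos k, by linarith [hsle k]⟩).1) h1
    · simpa [hs] using (pm_seq R).div_const 16
  have t1 : ‖u x - A 0‖ₑ ^ 2 ≤ 2 * ∑' k : ℕ, 2 ^ k * pmPhi H x (R * (1 / 2) ^ k) :=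
    pm_tel_lim A _ _ hlim (fun k => pm_chain_step u hu Ω R1 x c hc R hR (by linarith) k)
  have t3 : ‖B N - B 0‖ₑ ^ 2 ≤ 2 * ∑ k ∈ Finset.range N, 2 ^ k * pmPhi H z0 (R * (1 / 2) ^ k) :=
    pm_tel N B _ (fun k => pm_chain_step u hu Ω R1 z0 b hb R hR (by linarith) k)
  have hs0 : s 0 = R / 2 := by simp [hs]
  have hd1 := (hc _ hR2).1
  have hd2 := (hb _ hR2).1
  have t2 : ‖A 0 - B 0‖ₑ ^ 2 ≤ pmPhi H x0 (2 * R) := by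
    simp only [hA, hB, hs0]
    rw [show R / 2 / 16 = R / 32 by ring]
    refine pm_step u hu (interior Ω) isOpen_interior _ _ _ _ x0 (2 * R) (by linarith) (by linarith)
      (by linarith) ?_ ?_ (pmHalf z0 (4 * R) γ ν0) (pmHalf_convex _ _ _ _)
      (interior_maximal hA0 (pmHalf_open _ _ _ _)) hb0 hc0
    · exact ball_subset_ball' (by linarith [dist_triangle (b (R / 2)) z0 x0])
    · exact ball_subset_ball' (by linarith [dist_triangle (c (R / 2)) x x0])
  have t4 : ‖B N‖ₑ ^ 2 ≤ pmPhi H z0 (R * (1 / 2) ^ N) := by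
    have e : R * (1 / 2) ^ N = 2 * s N := by simp only [hs]; ring
    have hN := hspos N
    have hNR : s N ∈ Ioc 0 R1 := ⟨hN, by linarith [hsle N]⟩
    rw [e] at hD ⊢
    obtain ⟨hd3, K, hK, hKU, k1, k2⟩ := hb (s N) hNR
    obtain ⟨ν, hν, hA1, hB1⟩ := hflat z0 hz0 (s N) hNR
    have hdd : dist (z0 - (3 / 4 * s N) • ν) z0 = 3 / 4 * s N := by
      rw [dist_eq_norm, sub_sub_cancel_left, norm_neg, norm_smul, hν, mul_one,
        Real.norm_of_nonneg (by linarith)]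
    refine pm_dir u hu Ω (b (s N)) (z0 - (3 / 4 * s N) • ν) (s N / 16) (s N / 16) z0 (2 * s N)
      (by linarith) (by linarith) (by linarith) (ball_subset_ball' (by linarith))
      (ball_subset_ball' (by linarith)) (k1.trans hKU) ?_ hD
    rw [eq_empty_iff_forall_notMem]
    rintro p ⟨hp, hpΩ⟩
    have hpb : p ∈ ball z0 (s N) := ball_subset_ball' (by linarith) hp
    have h1 : -(γ * s N) < inner ℝ (p - z0) ν := hB1 ⟨hpΩ, hpb⟩
    have h2 := pm_inner_le (p - (z0 - (3 / 4 * s N) • ν)) ν hν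
    rw [← dist_eq_norm] at h2
    rw [mem_ball] at hp
    have h3 : inner ℝ (p - z0) ν = inner ℝ (p - (z0 - (3 / 4 * s N) • ν)) ν - 3 / 4 * s N := by
      rw [show p - (z0 - (3 / 4 * s N) • ν) = (p - z0) + (3 / 4 * s N) • ν by abel, inner_add_left,
        real_inner_smul_left, real_inner_self_eq_norm_sq, hν]
      ring
    have h4 : γ * s N ≤ 1 / 48 * s N := by
      have := hγ.2
      gcongr
    linarith [(abs_le.1 h2).2]
  have t3' : ‖B 0 - B N‖ₑ ^ 2 ≤ 2 * ∑ k ∈ Finset.range N, 2 ^ k * pmPhi H z0 (R * (1 / 2) ^ k) := by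
    rwa [← enorm_neg, neg_sub]
  calc ‖u x‖ₑ ^ 2 = ‖(u x - A 0) + ((A 0 - B 0) + ((B 0 - B N) + B N))‖ₑ ^ 2 := by
        congr 2; ring
    _ ≤ 2 * ‖u x - A 0‖ₑ ^ 2 + 2 * (2 * ‖A 0 - B 0‖ₑ ^ 2 + 2 * (2 * ‖B 0 - B N‖ₑ ^ 2 +
          2 * ‖B N‖ₑ ^ 2)) := by
        refine (pm_add_sq _ _).trans ?_
        gcongr
        refine (pm_add_sq _ _).trans ?_
        gcongr
        exact pm_add_sq _ _
    _ ≤ 2 * (2 * ∑' k : ℕ, 2 ^ k * pmPhi H x (R * (1 / 2) ^ k)) + 2 * (2 * pmPhi H x0 (2 * R) +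
          2 * (2 * (2 * ∑ k ∈ Finset.range N, 2 ^ k * pmPhi H z0 (R * (1 / 2) ^ k)) +
          2 * pmPhi H z0 (R * (1 / 2) ^ N))) := by
        gcongr
    _ = _ := by ring

lemma pm_main {d : ℕ} (u : Euc d → ℝ) (hu : ContDiff ℝ 1 u) (hsupp : HasCompactSupport u)
    (Ω : Set (Euc d)) (γ R1 : ℝ) (hγ : γ ∈ Set.Icc (0 : ℝ) (1 / 48)) (hflat : ReifenbergFlat Ω γ R1)
    (x0 z0 : Euc d) (hz0 : z0 ∈ frontier Ω) (R : ℝ) (hR : 0 < R) (hR1 : 4 * R ≤ R1)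
    (hzx : dist z0 x0 < R) (N : ℕ)
    (hD : ∀ y ∈ frontier Ω ∩ ball z0 (R * (1 / 2) ^ N), u y = 0) :
    ∫⁻ x in Ω ∩ ball x0 R, ‖u x‖ₑ ^ 2 ≤ (224 + 256 * 2 ^ N) *
      (ENNReal.ofReal (R ^ 2 * (64 * 2 ^ N) ^ d) *
        ∫⁻ y in ball x0 (2 * R), pmH u (interior Ω) y) := by
  set H := pmH u (interior Ω) with hH
  have hHm : Measurable H := pmH_meas u hu _ isOpen_interior
  set I := ∫⁻ y in ball x0 (2 * R), H y with hI
  set q : ℝ := (64 * 2 ^ N) ^ d with hq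
  set Q := ENNReal.ofReal (R ^ 2 * q) * I with hQ
  have h2N : (1:ℝ) ≤ 2 ^ N := one_le_pow₀ (by norm_num)
  have hpm : ∀ k : ℕ, Measurable fun x => 2 ^ k * pmPhi H x (R * (1 / 2) ^ k) := fun k =>
    (pm_phi_meas H hHm _).const_mul _
  have hpk : ∀ k : ℕ, ((1:ℝ) / 2) ^ k ≤ 1 := fun k => pow_le_one₀ (by norm_num) (by norm_num)
  set W := 4 * pmPhi H x0 (2 * R) +
      (16 * (∑ k ∈ Finset.range N, 2 ^ k * pmPhi H z0 (R * (1 / 2) ^ k)) +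
        8 * pmPhi H z0 (R * (1 / 2) ^ N)) with hW
  have htm : Measurable fun x => ∑' k : ℕ, 2 ^ k * pmPhi H x (R * (1 / 2) ^ k) :=
    Measurable.tsum hpm
  have hz : ∀ k ≤ N, pmPhi H z0 (R * (1 / 2) ^ k) * volume (ball x0 R) ≤ 16 * Q := by
    intro k hk
    have hRk : R * (1 / 2) ^ k ≤ R := by nlinarith [hpk k]
    refine pm_const H z0 x0 _ R (by positivity) hR (ball_subset_ball' (by linarith)) (by linarith)
      q ?_
    rw [hq]
    have e : 64 * R / (R * (1 / 2) ^ k) = 64 * 2 ^ k := by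
      rw [one_div, inv_pow]; field_simp
    rw [e]
    gcongr
    norm_num
  have hWv : W * volume (ball x0 R) ≤ (192 + 256 * 2 ^ N) * Q := by
    have w1 : pmPhi H x0 (2 * R) * volume (ball x0 R) ≤ 16 * Q := by
      refine pm_const H x0 x0 _ R (by positivity) hR subset_rfl le_rfl q ?_
      rw [hq]
      have e : 64 * R / (2 * R) = 32 := by field_simp; norm_num
      rw [e]
      gcongr
      linarith
    have w2 : (∑ k ∈ Finset.range N, 2 ^ k * pmPhi H z0 (R * (1 / 2) ^ k)) * volume (ball x0 R)
        ≤ 2 ^ N * (16 * Q) := by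
      rw [Finset.sum_mul]
      calc _ ≤ ∑ k ∈ Finset.range N, 2 ^ k * (16 * Q) := by
            refine Finset.sum_le_sum fun k hk => ?_
            rw [mul_assoc]
            exact mul_le_mul_right (hz k (Finset.mem_range.1 hk).le) _
        _ = (∑ k ∈ Finset.range N, 2 ^ k) * (16 * Q) := by rw [Finset.sum_mul]
        _ ≤ _ := by
            gcongr
            have := Nat.geomSum_eq (le_refl 2) N
            have h3 : ∑ k ∈ Finset.range N, 2 ^ k ≤ 2 ^ N := by
              rw [this]; simp
            exact_mod_cast h3
    calc W * volume (ball x0 R) = 4 * (pmPhi H x0 (2 * R) * volume (ball x0 R)) +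
          (16 * ((∑ k ∈ Finset.range N, 2 ^ k * pmPhi H z0 (R * (1 / 2) ^ k)) *
            volume (ball x0 R)) + 8 * (pmPhi H z0 (R * (1 / 2) ^ N) * volume (ball x0 R))) := by
          rw [hW]; ring
      _ ≤ 4 * (16 * Q) + (16 * (2 ^ N * (16 * Q)) + 8 * (16 * Q)) := by
          have w3 := hz N le_rfl
          exact add_le_add (mul_le_mul_right w1 _)
            (add_le_add (mul_le_mul_right w2 _) (mul_le_mul_right w3 _))
      _ = _ := by ring
  have hT : ∫⁻ x in ball x0 R, ∑' k : ℕ, 2 ^ k * pmPhi H x (R * (1 / 2) ^ k) ≤ 8 * Q := by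
    rw [lintegral_tsum fun k => (hpm k).aemeasurable]
    calc _ ≤ ∑' k : ℕ, (2⁻¹ : ℝ≥0∞) ^ k * (4 * Q) := by
          refine ENNReal.tsum_le_tsum fun k => ?_
          rw [lintegral_const_mul _ (pm_phi_meas H hHm _)]
          refine (mul_le_mul_right (pm_tonelli H hHm x0 _ R (by positivity)
            (by nlinarith [hpk k])) _).trans ?_
          rw [hQ, ← mul_assoc, ← mul_assoc 4, ← mul_assoc (2⁻¹ ^ k), ← mul_assoc (2⁻¹ ^ k)]
          refine mul_le_mul_left ?_ _
          have e1 : (2:ℝ≥0∞) ^ k = ENNReal.ofReal (2 ^ k) := by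
            rw [ENNReal.ofReal_pow (by norm_num)]; simp
          have e2 : (2⁻¹:ℝ≥0∞) ^ k = ENNReal.ofReal ((1 / 2) ^ k) := by
            rw [ENNReal.ofReal_pow (by norm_num), one_div,
              ENNReal.ofReal_inv_of_pos (by norm_num)]; simp
          rw [e1, e2, show (4:ℝ≥0∞) = ENNReal.ofReal 4 by simp,
            ← ENNReal.ofReal_mul (by positivity), ← ENNReal.ofReal_mul (by positivity),
            ← ENNReal.ofReal_mul (by positivity)]
          apply ENNReal.ofReal_le_ofReal
          have e3 : (2:ℝ) ^ k * ((2 * (R * (1 / 2) ^ k)) ^ 2 * 64 ^ d) =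
              (1 / 2) ^ k * 4 * (R ^ 2 * 64 ^ d) := by
            have : (2:ℝ) ^ k * (1 / 2) ^ k = 1 := by rw [← mul_pow]; norm_num
            linear_combination (4 * R ^ 2 * (1 / 2) ^ k * 64 ^ d) * this
          rw [e3, hq]
          gcongr
          linarith
      _ = 8 * Q := by
          rw [ENNReal.tsum_mul_right, ENNReal.tsum_geometric, ENNReal.one_sub_inv_two, inv_inv]
          ring
  calc ∫⁻ x in Ω ∩ ball x0 R, ‖u x‖ₑ ^ 2
      ≤ ∫⁻ x in Ω ∩ ball x0 R, (4 * (∑' k : ℕ, 2 ^ k * pmPhi H x (R * (1 / 2) ^ k)) + W) := by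
        refine setLIntegral_mono ((htm.const_mul 4).add_const W) fun x hx => ?_
        exact pm_point u hu hsupp Ω γ R1 hγ hflat x0 z0 hz0 R hR hR1 hzx N hD x
          (subset_closure hx.1) hx.2
    _ ≤ ∫⁻ x in ball x0 R, (4 * (∑' k : ℕ, 2 ^ k * pmPhi H x (R * (1 / 2) ^ k)) + W) :=
        lintegral_mono_set inter_subset_right
    _ = 4 * (∫⁻ x in ball x0 R, ∑' k : ℕ, 2 ^ k * pmPhi H x (R * (1 / 2) ^ k)) +
          W * volume (ball x0 R) := by
        rw [lintegral_add_right _ measurable_const, lintegral_const_mul _ htm, setLIntegral_const]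
    _ ≤ 4 * (8 * Q) + (192 + 256 * 2 ^ N) * Q := by gcongr
    _ = _ := by ring

/-- Poincaré inequality with mixed boundary condition on a Reifenberg flat domain:
if a definite portion of `∂Ω` near `x0` belongs to the Dirichlet set `D`, then every
smooth compactly supported function whose support avoids `D` satisfies
`‖u‖_{L²(Ω ∩ B_R(x0))} ≤ C R ‖∇u‖_{L²(Ω ∩ B_{2R}(x0))}` with `C = C(d, α)`. -/
theorem poincare_mixed (d : ℕ) (α : ℝ) (hα : α ∈ Set.Ioo (0 : ℝ) 1) :
    ∃ C > (0 : ℝ), ∀ γ ∈ Set.Icc (0 : ℝ) (1 / 48), ∀ R1 > (0 : ℝ),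
      ∀ Ω : Set (Euc d), ReifenbergFlat Ω γ R1 →
      ∀ D ⊆ frontier Ω, ∀ x0 ∈ closure Ω, ∀ R ∈ Set.Ioc (0 : ℝ) (R1 / 4),
        (D ∩ ball x0 R).Nonempty →
        ∀ z0 ∈ D ∩ ball x0 R,
          ball z0 (α * R) ⊆ ball x0 R →
          frontier Ω ∩ ball z0 (α * R) ⊆ D ∩ ball x0 R →
          ∀ u : Euc d → ℝ, IsTest u → Function.support u ∩ D = ∅ →
            ∫ x in Ω ∩ ball x0 R, (u x) ^ 2
              ≤ C ^ 2 * R ^ 2 * ∫ x in Ω ∩ ball x0 (2 * R), ‖gradVec u x‖ ^ 2 := by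
  obtain ⟨N, hN⟩ := exists_pow_lt_of_lt_one hα.1 (show (1 / 2 : ℝ) < 1 by norm_num)
  set q : ℝ := (64 * 2 ^ N) ^ d with hq
  have hq0 : 0 < (224 + 256 * 2 ^ N) * q := by positivity
  refine ⟨√((224 + 256 * 2 ^ N) * q), Real.sqrt_pos.2 hq0, ?_⟩
  intro γ hγ R1 _ Ω hflat D hDf x0 _ R hR _ z0 hz0 _ hfr u hu hsupp
  rw [Real.sq_sqrt hq0.le]
  have hR0 : 0 < R := hR.1
  have hu1 : ContDiff ℝ 1 u := hu.1.of_le (by exact_mod_cast le_top)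
  have hgc := pm_grad_cont u hu1
  have hmain := pm_main u hu1 hu.2 Ω γ R1 hγ hflat x0 z0 (hDf hz0.1) R hR0 (by linarith [hR.2])
    hz0.2 N (by
      rintro y ⟨hy, hyb⟩
      have h1 : y ∈ D := (hfr ⟨hy, ball_subset_ball (by nlinarith) hyb⟩).1
      by_contra hn
      have h2 : y ∈ Function.support u ∩ D := ⟨hn, h1⟩
      rw [hsupp] at h2
      exact h2)
  have hle : ∫⁻ y in ball x0 (2 * R), pmH u (interior Ω) y ≤
      ∫⁻ y in Ω ∩ ball x0 (2 * R), ENNReal.ofReal (‖gradVec u y‖ ^ 2) := by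
    rw [pmH, setLIntegral_indicator isOpen_interior.measurableSet]
    simp only [ENNReal.ofReal_pow (norm_nonneg _), ofReal_norm]
    exact lintegral_mono_set (inter_subset_inter_left _ interior_subset)
  have hcg : Continuous fun y => ‖gradVec u y‖ ^ 2 := by fun_prop
  have hfin : ∫⁻ y in Ω ∩ ball x0 (2 * R), ENNReal.ofReal (‖gradVec u y‖ ^ 2) ≠ ∞ := by
    have hint : IntegrableOn (fun y => ‖gradVec u y‖ ^ 2) (Ω ∩ ball x0 (2 * R)) :=
      (hcg.continuousOn.integrableOn_compact (isCompact_closedBall x0 (2 * R))).mono_set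
        (inter_subset_right.trans ball_subset_closedBall)
    have := hint.lintegral_lt_top
    exact this.ne
  rw [integral_eq_lintegral_of_nonneg_ae (Eventually.of_forall fun x => sq_nonneg _)
      (hu1.continuous.pow 2).aestronglyMeasurable,
    integral_eq_lintegral_of_nonneg_ae (Eventually.of_forall fun x => sq_nonneg _)
      hcg.aestronglyMeasurable]
  simp only [pm_enorm_sq] at hmain
  have hfinal := hmain.trans (mul_le_mul_right (mul_le_mul_right hle _) _)
  have h3 := ENNReal.toReal_mono (ENNReal.mul_ne_top (by finiteness)
    (ENNReal.mul_ne_top ENNReal.ofReal_ne_top hfin)) hfinal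
  refine h3.trans (le_of_eq ?_)
  rw [ENNReal.toReal_mul, ENNReal.toReal_mul, ENNReal.toReal_ofReal (by positivity),
    ENNReal.toReal_add (by finiteness) (by finiteness)]
  simp only [ENNReal.toReal_mul, ENNReal.toReal_pow, ENNReal.toReal_ofNat]
  rw [hq]
  ring
end
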